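/- arXiv:math/0603231 — 6 statements merged into one kernel-verified Lean document; each statement's English description precedes it below -/
import Mathlib

section
/- Let V = ℂ^n with its standard Hermitian inner product and let G be a finite subgroup of the unitary group U(V). Let g ∈ G and suppose that for some integer m ≥ 0 the space of χ_g-semi-invariants (S(V^g) ⊗ ⋀^m((V^g)^*))^{χ_g} = {s : h·s = χ_g(h)·s for all h ∈ Z(g)} is nonzero (where Z(g) acts diagonally on the tensor product). Then every h ∈ Z(g) whose restriction to V^g is the identity map satisfies det(h) = 1; in particular det(g) = 1. -/
open MvPolynomial Matrix Finset

attribute [local instance] Classical.propDecidable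

noncomputable section

/-- The group `G(r,p,n)` of monomial `n×n` matrices whose nonzero entries are `r`-th roots
of unity and such that the product of the nonzero entries raised to the `r/p` power is `1`.
(For a monomial matrix the product of the nonzero entries is `∏ i, ∑ j, M i j`.) -/
def GG (r p n : ℕ) : Set (Matrix (Fin n) (Fin n) ℂ) :=
  {M | (∃ (σ : Equiv.Perm (Fin n)) (d : Fin n → ℂ),
          (∀ j, d j ^ r = 1) ∧ ∀ i j, M i j = if i = σ j then d j else 0) ∧
       (∏ i, ∑ j, M i j) ^ (r / p) = 1}

/-- The centralizer of `g` in `G(r,p,n)`. -/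
def Zg (r p n : ℕ) (g : Matrix (Fin n) (Fin n) ℂ) : Set (Matrix (Fin n) (Fin n) ℂ) :=
  {h | h ∈ GG r p n ∧ h * g = g * h}

/-- The action of a matrix `M` on `S(V) = ℂ[v_1,…,v_n]`, sending the variable `X j`
(the `j`-th basis vector of `V`) to the linear form corresponding to `M · e_j`. -/
def act {n : ℕ} (M : Matrix (Fin n) (Fin n) ℂ) :
    MvPolynomial (Fin n) ℂ →ₐ[ℂ] MvPolynomial (Fin n) ℂ :=
  aeval fun j => ∑ i, C (M i j) * X i

/-- `S(V^g)`: the subalgebra of `S(V)` generated by the linear forms corresponding to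
vectors fixed by `g`. -/
def SVg {n : ℕ} (g : Matrix (Fin n) (Fin n) ℂ) : Subalgebra ℂ (MvPolynomial (Fin n) ℂ) :=
  Algebra.adjoin ℂ {q | ∃ c : Fin n → ℂ, g.mulVec c = c ∧ q = ∑ i, C (c i) * X i}

/-- The fixed space `V^g` inside Euclidean space `ℂⁿ`. -/
def fixedSpace {n : ℕ} (M : Matrix (Fin n) (Fin n) ℂ) :
    Submodule ℂ (EuclideanSpace ℂ (Fin n)) :=
  LinearMap.ker (Matrix.toEuclideanLin M - LinearMap.id)

/-- The determinant of the restriction of an endomorphism to an invariant subspace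
(junk value `0` if the subspace is not invariant). -/
def detOn {n : ℕ} (f : EuclideanSpace ℂ (Fin n) →ₗ[ℂ] EuclideanSpace ℂ (Fin n))
    (W : Submodule ℂ (EuclideanSpace ℂ (Fin n))) : ℂ :=
  if h : ∀ x ∈ W, f x ∈ W then LinearMap.det (f.restrict h) else 0

/-- The Hochschild character `χ_g(h) = det(h^⊥)`: the determinant of `h` restricted to the
orthogonal complement of the fixed space `V^g`. -/
def chi {n : ℕ} (g h : Matrix (Fin n) (Fin n) ℂ) : ℂ :=
  detOn (Matrix.toEuclideanLin h) (fixedSpace g)ᗮ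

theorem mem_fixedSpace_iff {n : ℕ} {M : Matrix (Fin n) (Fin n) ℂ} {v : EuclideanSpace ℂ (Fin n)} :
    v ∈ fixedSpace M ↔ Matrix.toEuclideanLin M v = v := by
  simp [fixedSpace, LinearMap.mem_ker, sub_eq_zero]

theorem inner_toEuclideanLin_unitary {n : ℕ} (h : Matrix.unitaryGroup (Fin n) ℂ)
    (x y : EuclideanSpace ℂ (Fin n)) :
    inner ℂ (Matrix.toEuclideanLin (h : Matrix (Fin n) (Fin n) ℂ) x)
      (Matrix.toEuclideanLin (h : Matrix (Fin n) (Fin n) ℂ) y) = inner ℂ x y := by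
  have hu : (h : Matrix (Fin n) (Fin n) ℂ)ᴴ * (h : Matrix (Fin n) (Fin n) ℂ) = 1 :=
    Matrix.mem_unitaryGroup_iff'.mp h.2
  rw [← LinearMap.adjoint_inner_right, ← Matrix.toEuclideanLin_conjTranspose_eq_adjoint]
  simp only [Matrix.toLpLin_apply, Matrix.mulVec_mulVec, hu, Matrix.one_mulVec]

/-- A unitary matrix fixing `W` pointwise has the same determinant as its restriction to `Wᗮ`. -/
theorem detOn_orthogonal_eq_det {n : ℕ} (h : Matrix.unitaryGroup (Fin n) ℂ)
    (W : Submodule ℂ (EuclideanSpace ℂ (Fin n)))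
    (hW : ∀ v ∈ W, Matrix.toEuclideanLin (h : Matrix (Fin n) (Fin n) ℂ) v = v) :
    detOn (Matrix.toEuclideanLin (h : Matrix (Fin n) (Fin n) ℂ)) Wᗮ =
      Matrix.det (h : Matrix (Fin n) (Fin n) ℂ) := by
  set f := Matrix.toEuclideanLin (h : Matrix (Fin n) (Fin n) ℂ) with hf
  have hinv : ∀ x ∈ Wᗮ, f x ∈ Wᗮ := by
    intro x hx
    rw [Submodule.mem_orthogonal] at hx ⊢
    intro u hu
    rw [← hW u hu, inner_toEuclideanLin_unitary, hx u hu]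
  rw [detOn, dif_pos hinv]
  let e := Submodule.prodEquivOfIsCompl W Wᗮ W.isCompl_orthogonal
  have hconj : f = (e : (W × Wᗮ) →ₗ[ℂ] _) ∘ₗ (LinearMap.id.prodMap (f.restrict hinv)) ∘ₗ
      (e.symm : _ →ₗ[ℂ] (W × Wᗮ)) := by
    rw [← LinearMap.comp_assoc, LinearEquiv.eq_comp_toLinearMap_symm]
    refine LinearMap.ext fun x => ?_
    simp [e, hW]
  rw [← LinearMap.det_toLpLin 2 (h : Matrix (Fin n) (Fin n) ℂ)]
  change _ = LinearMap.det f
  conv_rhs => rw [hconj]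
  rw [LinearMap.det_conj, LinearMap.det_prodMap, LinearMap.det_id, one_mul]

theorem act_eq_self_of_mem_SVg {n : ℕ} {g h : Matrix (Fin n) (Fin n) ℂ}
    (hfix : ∀ v ∈ fixedSpace g, Matrix.toEuclideanLin h v = v)
    {q : MvPolynomial (Fin n) ℂ} (hq : q ∈ SVg g) : act h q = q := by
  suffices SVg g ≤ AlgHom.equalizer (act h) (AlgHom.id ℂ _) from this hq
  refine Algebra.adjoin_le ?_
  rintro _ ⟨c, hc, rfl⟩
  have hhc : h *ᵥ c = c := by
    have := hfix (WithLp.toLp 2 c) (by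
      rw [mem_fixedSpace_iff, Matrix.toLpLin_toLp, Matrix.toLin'_apply, hc])
    rw [Matrix.toLpLin_toLp] at this
    exact congrArg WithLp.ofLp this
  change act h _ = ∑ i, C (c i) * X i
  simp only [act, map_sum, map_mul, aeval_X, algHom_C, algebraMap_eq, Finset.mul_sum]
  rw [Finset.sum_comm]
  refine Finset.sum_congr rfl fun i _ => ?_
  conv_rhs => rw [← hhc]
  simp only [Matrix.mulVec, dotProduct, map_sum, map_mul, Finset.sum_mul]
  exact Finset.sum_congr rfl fun j _ => by ring

/-- An alternating map vanishing as soon as one argument lies in `Wᗮ` is determined by its values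
on `W`. -/
theorem AlternatingMap.map_starProjection_eq {E M ι : Type*} [NormedAddCommGroup E]
    [InnerProductSpace ℂ E] [AddCommGroup M] [Module ℂ M] [Fintype ι]
    (s : E [⋀^ι]→ₗ[ℂ] M) (W : Submodule ℂ E) [W.HasOrthogonalProjection]
    (hs : ∀ (w : ι → E) (i : ι), w i ∈ Wᗮ → s w = 0) (w : ι → E) :
    s (fun i => W.starProjection (w i)) = s w := by
  suffices ∀ t : Finset ι, s (t.piecewise (fun i => W.starProjection (w i)) w) = s w by
    simpa using this Finset.univ
  intro t
  induction t using Finset.induction_on with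
  | empty => simp
  | insert i t hi ih =>
    rw [← ih, Finset.piecewise_insert, ← sub_eq_zero]
    set p := t.piecewise (fun i => W.starProjection (w i)) w with hp
    have hpi : p i = w i := by simp [hp, hi]
    conv_lhs => rw [← Function.update_eq_self i p]
    rw [Function.update_idem, hpi, ← s.map_update_sub]
    refine hs _ i ?_
    rw [Function.update_self, ← neg_sub]
    exact neg_mem (W.sub_starProjection_mem_orthogonal (w i))

/-- Let `V = ℂⁿ` and let `G` be a finite subgroup of the unitary group
`U(V)`.  Let `g ∈ G` and suppose that for some `m ≥ 0` the space of `χ_g`-semi-invariants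
`(S(V^g) ⊗ ⋀^m((V^g)^*))^{χ_g}` is nonzero.  Here an element of
`S(V^g) ⊗ ⋀^m((V^g)^*)` is encoded as an alternating `m`-linear map `s` on `V` with
values in the subalgebra `S(V^g)` which vanishes whenever one argument lies in `(V^g)^⊥`,
and semi-invariance means `h·(s(w)) = χ_g(h)·s(h·w)` for all `h ∈ Z(g)`.  Then every
`h ∈ Z(g)` whose restriction to `V^g` is the identity satisfies `det h = 1`;
in particular `det g = 1`. -/
theorem det_one_of_semiinvariant_nonzero
    (n : ℕ) (G : Subgroup (Matrix.unitaryGroup (Fin n) ℂ)) (hGfin : Finite G)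
    (g : Matrix.unitaryGroup (Fin n) ℂ) (hg : g ∈ G) (m : ℕ)
    (s : (EuclideanSpace ℂ (Fin n)) [⋀^Fin m]→ₗ[ℂ] MvPolynomial (Fin n) ℂ)
    (hs0 : s ≠ 0)
    (hval : ∀ w, s w ∈ SVg (g : Matrix (Fin n) (Fin n) ℂ))
    (hsupp : ∀ (w : Fin m → EuclideanSpace ℂ (Fin n)) (i : Fin m),
        w i ∈ (fixedSpace (g : Matrix (Fin n) (Fin n) ℂ))ᗮ → s w = 0)
    (hsemi : ∀ h : Matrix.unitaryGroup (Fin n) ℂ, h ∈ G → h * g = g * h →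
        ∀ w : Fin m → EuclideanSpace ℂ (Fin n),
          act (h : Matrix (Fin n) (Fin n) ℂ) (s w)
            = chi (g : Matrix (Fin n) (Fin n) ℂ) (h : Matrix (Fin n) (Fin n) ℂ) •
                s fun i => Matrix.toEuclideanLin (h : Matrix (Fin n) (Fin n) ℂ) (w i)) :
    (∀ h : Matrix.unitaryGroup (Fin n) ℂ, h ∈ G → h * g = g * h →
        (∀ v ∈ fixedSpace (g : Matrix (Fin n) (Fin n) ℂ),
          Matrix.toEuclideanLin (h : Matrix (Fin n) (Fin n) ℂ) v = v) →
        Matrix.det (h : Matrix (Fin n) (Fin n) ℂ) = 1)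
    ∧ Matrix.det (g : Matrix (Fin n) (Fin n) ℂ) = 1 := by
  have main : ∀ h : Matrix.unitaryGroup (Fin n) ℂ, h ∈ G → h * g = g * h →
      (∀ v ∈ fixedSpace (g : Matrix (Fin n) (Fin n) ℂ),
        Matrix.toEuclideanLin (h : Matrix (Fin n) (Fin n) ℂ) v = v) →
      Matrix.det (h : Matrix (Fin n) (Fin n) ℂ) = 1 := by
    intro h hh hcomm hfix
    obtain ⟨w, hw⟩ : ∃ w, s w ≠ 0 := by
      by_contra! hzero
      exact hs0 (AlternatingMap.ext hzero)
    set W := fixedSpace (g : Matrix (Fin n) (Fin n) ℂ)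
    rw [← s.map_starProjection_eq W hsupp w] at hw
    have hsw := hsemi h hh hcomm fun i => W.starProjection (w i)
    rw [act_eq_self_of_mem_SVg hfix (hval _),
      funext fun i => hfix _ (W.starProjection_apply_mem (w i))] at hsw
    rw [← detOn_orthogonal_eq_det h W hfix]
    change chi (g : Matrix (Fin n) (Fin n) ℂ) (h : Matrix (Fin n) (Fin n) ℂ) = 1
    exact (smul_left_injective ℂ hw (by simpa only [one_smul] using hsw)).symm
  exact ⟨main, main g hg rfl fun v hv => mem_fixedSpace_iff.mp hv⟩

end
end

section
/- Assume n ≥ 4, r even, and r/p even, and let G = G(r,p,n) and g = (1,−2) := ξ_2^{r/2}(1,2) ∈ G(r,p,n) (so g sends v_2 ↦ v_1 and v_1 ↦ −v_2). Set n' = n−2, f_i = e_i(v_3^r,…,v_n^r) for 1 ≤ i ≤ n'−1, and f_{n'} = (v_3⋯v_n)^{r/p}. Then S(V^g)^{Z(g)} = ℂ[f_1,…,f_{n'−1}, f_{n'}^{p/2}] if p is even, and S(V^g)^{Z(g)} = ℂ[f_1,…,f_{n'−1}, f_{n'}^{p}] if p is odd. -/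
open MvPolynomial Matrix Finset

attribute [local instance] Classical.propDecidable

noncomputable section

/-- The element `(1,−2) = ξ₂^{r/2}(1,2)`, sending `v₂ ↦ v₁` and `v₁ ↦ −v₂`
(the nonzero entry in column `1` is `ξ^{r/2} = −1`). -/
def gOneMinusTwo (r n : ℕ) [NeZero n] (ξ : ℂ) : Matrix (Fin n) (Fin n) ℂ :=
  Matrix.of fun i j : Fin n =>
    if i = Equiv.swap (0 : Fin n) 1 j then (if j = 0 then ξ ^ (r / 2) else 1) else 0

/-- `f_i`: the `i`-th elementary symmetric polynomial in `v₃^r, …, v_n^r`. -/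
def fmid (r n : ℕ) (i : ℕ) : MvPolynomial (Fin n) ℂ :=
  ∑ s ∈ Finset.powersetCard i (Finset.univ.filter fun t : Fin n => 2 ≤ (t : ℕ)),
    ∏ t ∈ s, X t ^ r

/-- `f_{n'} = (v₃ ⋯ v_n)^{r/p}`. -/
def flast (r p n : ℕ) : MvPolynomial (Fin n) ℂ :=
  ∏ t ∈ Finset.univ.filter fun t : Fin n => 2 ≤ (t : ℕ), X t ^ (r / p)

/-- The index type of the coordinates `v₃, …, v_n`. -/
abbrev FixedIdx (n : ℕ) : Type := {t : Fin n // 2 ≤ (t : ℕ)}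

/-- The monomial matrix sending the `j`-th basis vector to `d j` times the `σ j`-th one. -/
def monomialMatrix {n : ℕ} (σ : Equiv.Perm (Fin n)) (d : Fin n → ℂ) :
    Matrix (Fin n) (Fin n) ℂ :=
  Matrix.of fun i j => if i = σ j then d j else 0

lemma act_monomialMatrix_X {n : ℕ} (σ : Equiv.Perm (Fin n)) (d : Fin n → ℂ) (j : Fin n) :
    act (monomialMatrix σ d) (X j) = C (d j) * X (σ j) := by
  simp [act, monomialMatrix, apply_ite C, ite_mul]

lemma monomialMatrix_mul {n : ℕ} (σ τ : Equiv.Perm (Fin n)) (d e : Fin n → ℂ) :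
    monomialMatrix σ d * monomialMatrix τ e =
      monomialMatrix (σ * τ) (fun j => d (τ j) * e j) := by
  ext i j
  simp only [monomialMatrix, Matrix.mul_apply, Matrix.of_apply, mul_ite, mul_zero,
    Finset.sum_ite_eq', Finset.mem_univ, if_true, ite_mul, zero_mul, Equiv.Perm.mul_apply]
  split_ifs with h
  · exact (if_pos h).symm
  · exact (if_neg h).symm

lemma prod_sum_monomialMatrix {n : ℕ} (σ : Equiv.Perm (Fin n)) (d : Fin n → ℂ) :
    ∏ i, ∑ j, monomialMatrix σ d i j = ∏ j, d j := by
  rw [← Equiv.prod_comp σ]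
  simp [monomialMatrix]

lemma exists_eq_monomialMatrix {r p n : ℕ} {h : Matrix (Fin n) (Fin n) ℂ} (hh : h ∈ GG r p n) :
    ∃ σ d, (∀ j, d j ^ r = 1) ∧ h = monomialMatrix σ d ∧ (∏ j, d j) ^ (r / p) = 1 := by
  obtain ⟨⟨σ, d, hd, hM⟩, hψ⟩ := hh
  have e : h = monomialMatrix σ d := by
    ext i j
    simp [hM, monomialMatrix]
  refine ⟨σ, d, hd, e, ?_⟩
  rwa [e, prod_sum_monomialMatrix] at hψ

lemma monomialMatrix_mem_GG {r p n : ℕ} {σ : Equiv.Perm (Fin n)} {d : Fin n → ℂ}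
    (hd : ∀ j, d j ^ r = 1) (hψ : (∏ j, d j) ^ (r / p) = 1) :
    monomialMatrix σ d ∈ GG r p n :=
  ⟨⟨σ, d, hd, fun _ _ => rfl⟩, by rwa [prod_sum_monomialMatrix]⟩

lemma gOneMinusTwo_eq (r n : ℕ) [NeZero n] (ξ : ℂ) :
    gOneMinusTwo r n ξ =
      monomialMatrix (Equiv.swap 0 1) (fun j => if j = 0 then ξ ^ (r / 2) else 1) := rfl

lemma monomialMatrix_mem_Zg {r p n : ℕ} [NeZero n] {ξ : ℂ} {σ : Equiv.Perm (Fin n)}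
    {d : Fin n → ℂ} (hd : ∀ j, d j ^ r = 1) (hψ : (∏ j, d j) ^ (r / p) = 1)
    (hσ0 : σ 0 = 0) (hσ1 : σ 1 = 1) (hd01 : d 0 = d 1) :
    monomialMatrix σ d ∈ Zg r p n (gOneMinusTwo r n ξ) := by
  refine ⟨monomialMatrix_mem_GG hd hψ, ?_⟩
  rw [gOneMinusTwo_eq, monomialMatrix_mul, monomialMatrix_mul]
  congr 1
  · rw [Equiv.mul_swap_eq_swap_mul, hσ0, hσ1]
  · funext j
    have h1 : σ j = 0 ↔ j = 0 :=
      ⟨fun h => σ.injective (h.trans hσ0.symm), fun h => by rw [h, hσ0]⟩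
    have h2 : d (Equiv.swap 0 1 j) = d j := by
      rw [Equiv.swap_apply_def]
      split_ifs with h h'
      · rw [h, hd01]
      · rw [h', hd01]
      · rfl
    simp only [h1, h2]
    ring

lemma coeff_act_diagonal {n : ℕ} (d : Fin n → ℂ) (f : MvPolynomial (Fin n) ℂ) (e : Fin n →₀ ℕ) :
    coeff e (act (monomialMatrix 1 d) f) = (∏ j, d j ^ e j) * coeff e f := by
  induction f using MvPolynomial.induction_on' with
  | monomial u a =>
    have : act (monomialMatrix 1 d) (monomial u a) = monomial u ((∏ j, d j ^ u j) * a) := by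
      rw [monomial_eq, map_mul, Finsupp.prod_fintype _ _ (by simp), map_prod,
        monomial_eq, Finsupp.prod_fintype _ _ (by simp)]
      simp only [map_pow, act_monomialMatrix_X, mul_pow, Finset.prod_mul_distrib,
        Equiv.Perm.one_apply, map_mul, map_prod]
      rw [← algebraMap_eq, AlgHom.commutes]
      ring
    rw [this, coeff_monomial, coeff_monomial]
    split_ifs with h
    · rw [h]
    · simp
  | add p q hp hq => simp [hp, hq, mul_add]

/-- Averaging over the symmetric group: a symmetric polynomial each of whose exponents is
congruent modulo `r` to a constant multiple of `q` is a polynomial in the `q`-th power of the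
product of the variables and in elementary symmetric polynomials of the `r`-th powers. -/
lemma MvPolynomial.IsSymmetric.mem_adjoin_of_support {σ : Type*} [Fintype σ] {q r : ℕ}
    {g : MvPolynomial σ ℂ} (hg : g.IsSymmetric)
    (h : ∀ e ∈ g.support, ∃ (c : ℕ) (k : σ →₀ ℕ), ∀ j, e j = q * c + r * k j) :
    g ∈ Algebra.adjoin ℂ (insert ((∏ j, X j) ^ q)
      ((fun i => expand r (esymm σ ℂ i)) '' Set.Ico 1 (Fintype.card σ + 1))) := by
  set A := Algebra.adjoin ℂ (insert ((∏ j, X j) ^ q)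
      ((fun i => expand r (esymm σ ℂ i)) '' Set.Ico 1 (Fintype.card σ + 1)))
  have hsymm : ∀ s : MvPolynomial σ ℂ, s.IsSymmetric → expand r s ∈ A := by
    intro s hs
    obtain ⟨Q, hQ⟩ := esymmAlgHom_surjective (σ := σ) ℂ le_rfl ⟨s, hs⟩
    have hQ' : s = aeval (fun i : Fin (Fintype.card σ) => esymm σ ℂ (i + 1)) Q := by
      have := congrArg (symmetricSubalgebra σ ℂ).val hQ
      rw [esymmAlgHom, comp_aeval_apply] at this
      exact this.symm
    rw [hQ', comp_aeval_apply]
    have : ∀ Q : MvPolynomial (Fin (Fintype.card σ)) ℂ,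
        aeval (fun i : Fin (Fintype.card σ) => expand r (esymm σ ℂ (i + 1))) Q ∈ A := by
      intro Q
      induction Q using MvPolynomial.induction_on with
      | C a => rw [aeval_C]; exact A.algebraMap_mem a
      | add p q hp hq => rw [map_add]; exact A.add_mem hp hq
      | mul_X p i hp =>
        rw [map_mul, aeval_X]
        refine A.mul_mem hp (Algebra.subset_adjoin (Or.inr ⟨i + 1, ⟨by omega, by omega⟩, rfl⟩))
    exact this Q
  have hmon : ∀ e ∈ g.support, ∑ τ : Equiv.Perm σ, rename τ (monomial e (1 : ℂ)) ∈ A := by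
    intro e he
    obtain ⟨c, k, hk⟩ := h e he
    have h1 : monomial e (1 : ℂ) = ((∏ j, X j) ^ q) ^ c * expand r (monomial k 1) := by
      rw [expand_monomial, monomial_eq, monomial_eq, Finsupp.prod_fintype _ _ (by simp),
        Finsupp.prod_fintype _ _ (by simp), ← pow_mul, ← Finset.prod_pow,
        C_1, one_mul, one_mul, ← Finset.prod_mul_distrib]
      refine Finset.prod_congr rfl fun j _ => ?_
      rw [hk, pow_add, Finsupp.smul_apply, smul_eq_mul]
    have h2 : ∀ τ : Equiv.Perm σ, rename τ (monomial e (1 : ℂ)) =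
        ((∏ j, X j) ^ q) ^ c * expand r (rename τ (monomial k 1)) := by
      intro τ
      rw [h1, map_mul, rename_expand, map_pow, map_pow, map_prod]
      simp only [rename_X]
      rw [Equiv.prod_comp τ (fun j => (X j : MvPolynomial σ ℂ))]
    simp only [h2]
    rw [← Finset.mul_sum, ← map_sum]
    refine A.mul_mem (A.pow_mem (Algebra.subset_adjoin (Set.mem_insert _ _)) _) (hsymm _ ?_)
    intro π
    rw [map_sum]
    simp only [rename_rename, ← Equiv.Perm.coe_mul]
    exact Fintype.sum_equiv (Equiv.mulLeft π) _ _ fun _ => rfl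
  have hsum : (Fintype.card (Equiv.Perm σ) : ℂ) • g =
      ∑ e ∈ g.support, coeff e g • ∑ τ : Equiv.Perm σ, rename τ (monomial e (1 : ℂ)) := by
    calc (Fintype.card (Equiv.Perm σ) : ℂ) • g = ∑ τ : Equiv.Perm σ, rename τ g := by
          rw [Finset.sum_congr rfl fun τ _ => hg τ, Finset.sum_const, Finset.card_univ,
            Nat.cast_smul_eq_nsmul]
      _ = _ := by
          simp only [Finset.smul_sum]
          rw [Finset.sum_comm]
          refine Finset.sum_congr rfl fun τ _ => ?_
          conv_lhs => rw [g.as_sum, map_sum]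
          refine Finset.sum_congr rfl fun e _ => ?_
          rw [← map_smul, smul_monomial, smul_eq_mul, mul_one]
  have hne : (Fintype.card (Equiv.Perm σ) : ℂ) ≠ 0 := by
    exact_mod_cast Fintype.card_ne_zero
  have : g = (Fintype.card (Equiv.Perm σ) : ℂ)⁻¹ • (Fintype.card (Equiv.Perm σ) : ℂ) • g := by
    rw [smul_smul, inv_mul_cancel₀ hne, one_smul]
  rw [this, hsum]
  exact A.smul_mem (A.sum_mem fun e he => A.smul_mem (hmon e he) _) _

lemma map_subtype_univ_fixedIdx (n : ℕ) :
    (Finset.univ : Finset (FixedIdx n)).map (Function.Embedding.subtype _) =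
      Finset.univ.filter fun t : Fin n => 2 ≤ (t : ℕ) := by
  ext t
  simp

lemma rename_expand_esymm (r n i : ℕ) :
    rename Subtype.val (expand r (esymm (FixedIdx n) ℂ i)) = fmid r n i := by
  rw [fmid, ← map_subtype_univ_fixedIdx, Finset.powersetCard_map, Finset.sum_map, esymm]
  simp [map_sum, map_prod, Finset.prod_map]

lemma rename_prod_X_pow (n q : ℕ) :
    rename Subtype.val ((∏ j : FixedIdx n, (X j : MvPolynomial _ ℂ)) ^ q) =
      ∏ t ∈ Finset.univ.filter fun t : Fin n => 2 ≤ (t : ℕ), X t ^ q := by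
  rw [← map_subtype_univ_fixedIdx, Finset.prod_map]
  simp [map_prod, Finset.prod_pow]

lemma flast_pow (r p n a : ℕ) :
    flast r p n ^ a =
      rename Subtype.val ((∏ j : FixedIdx n, (X j : MvPolynomial _ ℂ)) ^ (r / p * a)) := by
  rw [rename_prod_X_pow, flast, ← Finset.prod_pow]
  simp only [pow_mul]

lemma val_one_of_two_le {n : ℕ} [NeZero n] (hn : 2 ≤ n) : ((1 : Fin n) : ℕ) = 1 := by
  rw [Fin.val_one', Nat.mod_eq_of_lt hn]

lemma two_le_val_iff {n : ℕ} [NeZero n] (hn : 2 ≤ n) (t : Fin n) :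
    2 ≤ (t : ℕ) ↔ t ≠ 0 ∧ t ≠ 1 := by
  simp only [ne_eq, Fin.ext_iff, val_one_of_two_le hn, Fin.val_zero]
  omega

lemma zero_ne_one_of_two_le {n : ℕ} [NeZero n] (hn : 2 ≤ n) : (0 : Fin n) ≠ 1 := by
  simp only [ne_eq, Fin.ext_iff, val_one_of_two_le hn, Fin.val_zero]
  omega

lemma prod_eq_mul_prod_fixedIdx {n : ℕ} [NeZero n] (hn : 2 ≤ n) (d : Fin n → ℂ) :
    ∏ j, d j = d 0 * d 1 * ∏ j : FixedIdx n, d j := by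
  have h1 : ∏ j : FixedIdx n, d j =
      ∏ t ∈ Finset.univ.filter fun t : Fin n => 2 ≤ (t : ℕ), d t := by
    rw [← map_subtype_univ_fixedIdx, Finset.prod_map]
    rfl
  have h2 : (Finset.univ.filter fun t : Fin n => ¬ 2 ≤ (t : ℕ)) = {0, 1} := by
    ext t
    simp only [two_le_val_iff hn, Finset.mem_filter, Finset.mem_univ, true_and,
      Finset.mem_insert, Finset.mem_singleton]
    tauto
  rw [h1, ← Finset.prod_filter_mul_prod_filter_not _ (fun t : Fin n => 2 ≤ (t : ℕ)), h2,
    Finset.prod_pair (zero_ne_one_of_two_le hn), mul_comm]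

lemma pow_half_eq_neg_one {r : ℕ} (hr : r ≠ 0) (hreven : 2 ∣ r) {ξ : ℂ}
    (hξ : IsPrimitiveRoot ξ r) : ξ ^ (r / 2) = -1 := by
  obtain ⟨s, rfl⟩ := hreven
  have := hξ.pow (by omega) (mul_comm 2 s)
  rw [Nat.mul_div_cancel_left _ two_pos]
  exact this.eq_neg_one_of_two_right

lemma SVg_gOneMinusTwo {r n : ℕ} [NeZero n] (hn : 2 ≤ n) (hr : r ≠ 0) (hreven : 2 ∣ r) {ξ : ℂ}
    (hξ : IsPrimitiveRoot ξ r) :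
    SVg (gOneMinusTwo r n ξ) = (rename (Subtype.val : FixedIdx n → Fin n)).range := by
  have h01 := zero_ne_one_of_two_le hn
  have hg : ∀ c : Fin n → ℂ, ∀ i, (gOneMinusTwo r n ξ).mulVec c i =
      (if Equiv.swap 0 1 i = 0 then -1 else 1) * c (Equiv.swap 0 1 i) := by
    intro c i
    simp only [gOneMinusTwo, Matrix.mulVec, dotProduct, Matrix.of_apply,
      pow_half_eq_neg_one hr hreven hξ]
    rw [Finset.sum_eq_single (Equiv.swap 0 1 i)]
    · simp
    · intro j _ hj
      rw [if_neg, zero_mul]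
      rintro rfl
      simp at hj
    · simp
  apply le_antisymm
  · refine Algebra.adjoin_le ?_
    rintro _ ⟨c, hc, rfl⟩
    have e0 := congrFun hc 0
    have e1 := congrFun hc 1
    rw [hg] at e0 e1
    simp only [Equiv.swap_apply_left, Equiv.swap_apply_right, if_neg h01.symm, if_true] at e0 e1
    have c0 : c 0 = 0 := by linear_combination (-e1 - e0) / 2
    have c1 : c 1 = 0 := by linear_combination (e0 - e1) / 2
    refine Subalgebra.sum_mem _ fun i _ => ?_
    by_cases hi : 2 ≤ (i : ℕ)
    · exact ⟨C (c i) * X ⟨i, hi⟩, by simp⟩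
    · have : c i = 0 := by
        rw [two_le_val_iff hn] at hi
        by_cases h0 : i = 0
        · rw [h0, c0]
        · rw [show i = 1 by tauto, c1]
      rw [this, C_0, zero_mul]
      exact Subalgebra.zero_mem _
  · rintro _ ⟨g, rfl⟩
    change rename _ g ∈ _
    rw [← aeval_X_left_apply (rename Subtype.val g), aeval_rename]
    induction g using MvPolynomial.induction_on with
    | C a => rw [aeval_C]; exact Subalgebra.algebraMap_mem _ a
    | add p q hp hq => rw [map_add]; exact Subalgebra.add_mem _ hp hq
    | mul_X p i hp =>
      rw [map_mul, aeval_X]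
      refine Subalgebra.mul_mem _ hp (Algebra.subset_adjoin ⟨Pi.single i.1 1, ?_, ?_⟩)
      · funext j
        rw [hg]
        obtain ⟨i0, i1⟩ := (two_le_val_iff hn i.1).1 i.2
        rw [Equiv.swap_apply_def]
        split_ifs with h1 h2 h3 h4
        · exact absurd h2 h01.symm
        · simp [h1, i0.symm, i1.symm]
        · simp [h3, i0.symm, i1.symm]
        · simp_all
        · simp
      · simp [Pi.single_apply, apply_ite C, ite_mul]

/-- The structure of the centralizer of `(1,-2)`. -/
lemma exists_of_mem_Zg {r p n : ℕ} [NeZero n] (hn : 2 ≤ n) (hr : r ≠ 0)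
    (hreven : 2 ∣ r) {ξ : ℂ} (hξ : IsPrimitiveRoot ξ r) {h : Matrix (Fin n) (Fin n) ℂ}
    (hh : h ∈ Zg r p n (gOneMinusTwo r n ξ)) :
    ∃ (σ : Equiv.Perm (Fin n)) (d : Fin n → ℂ), h = monomialMatrix σ d ∧ (∀ j, d j ^ r = 1) ∧
      (∏ j, d j) ^ (r / p) = 1 ∧ (∀ t : Fin n, 2 ≤ (σ t : ℕ) ↔ 2 ≤ (t : ℕ)) ∧
      d 0 ^ 2 = d 1 ^ 2 := by
  have h01 := zero_ne_one_of_two_le hn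
  obtain ⟨hG, hcomm⟩ := hh
  obtain ⟨σ, d, hd, rfl, hψ⟩ := exists_eq_monomialMatrix hG
  rw [gOneMinusTwo_eq, monomialMatrix_mul, monomialMatrix_mul,
    pow_half_eq_neg_one hr hreven hξ] at hcomm
  have hd0 : ∀ j, d j ≠ 0 := fun j h0 => by
    have := hd j
    rw [h0, zero_pow hr] at this
    exact zero_ne_one this
  have key : ∀ j, σ (Equiv.swap 0 1 j) = Equiv.swap 0 1 (σ j) ∧
      d (Equiv.swap 0 1 j) * (if j = 0 then -1 else 1) = (if σ j = 0 then -1 else 1) * d j := by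
    intro j
    have := congrFun (congrFun hcomm (σ (Equiv.swap 0 1 j))) j
    simp only [monomialMatrix, Matrix.of_apply] at this
    rw [if_pos (Equiv.Perm.mul_apply _ _ _).symm] at this
    by_cases hc : σ (Equiv.swap 0 1 j) = Equiv.swap 0 1 (σ j)
    · exact ⟨hc, this.trans (if_pos hc)⟩
    · replace this := this.trans (if_neg hc)
      exfalso
      have := hd0 (Equiv.swap 0 1 j)
      split_ifs at * <;> simp_all
  refine ⟨σ, d, rfl, hd, hψ, fun t => ?_, ?_⟩
  · have fix : ∀ t : Fin n, 2 ≤ (t : ℕ) ↔ Equiv.swap 0 1 t = t := by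
      intro t
      rw [two_le_val_iff hn, Equiv.swap_apply_def]
      split_ifs with h1 h2
      · simp [h1, h01.symm]
      · simp [h2, h01]
      · simp [h1, h2]
    rw [fix, fix, ← (key t).1, σ.injective.eq_iff]
  · have := (key 0).2
    simp only [Equiv.swap_apply_left, if_true] at this
    have h2 := congrArg (· ^ 2) this
    simp only [mul_pow] at h2
    split_ifs at h2 <;> linear_combination -h2

lemma act_rename_expand {r n : ℕ} {σ : Equiv.Perm (Fin n)} {d : Fin n → ℂ}
    (hd : ∀ j, d j ^ r = 1) (hσ : ∀ t : Fin n, 2 ≤ (σ t : ℕ) ↔ 2 ≤ (t : ℕ))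
    (P : MvPolynomial (FixedIdx n) ℂ) :
    act (monomialMatrix σ d) (rename Subtype.val (expand r P)) =
      rename Subtype.val (expand r (rename (σ.subtypePerm hσ) P)) := by
  induction P using MvPolynomial.induction_on with
  | C a => simp [act]
  | add p q hp hq => simp only [map_add, hp, hq]
  | mul_X p i hp =>
    simp only [map_mul, hp, expand_X, rename_X, map_pow, act_monomialMatrix_X, mul_pow]
    rw [← C_pow, hd]
    simp

lemma act_rename_prod_X {n : ℕ} {σ : Equiv.Perm (Fin n)} {d : Fin n → ℂ}
    (hσ : ∀ t : Fin n, 2 ≤ (σ t : ℕ) ↔ 2 ≤ (t : ℕ)) :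
    act (monomialMatrix σ d)
        (rename Subtype.val (∏ j : FixedIdx n, (X j : MvPolynomial _ ℂ))) =
      C (∏ j : FixedIdx n, d j) *
        rename Subtype.val (∏ j : FixedIdx n, (X j : MvPolynomial _ ℂ)) := by
  simp only [map_prod, rename_X, act_monomialMatrix_X, Finset.prod_mul_distrib]
  congr 1
  exact Equiv.prod_comp (σ.subtypePerm hσ) fun j => (X j.1 : MvPolynomial (Fin n) ℂ)

lemma diagonal_mem_Zg {r p n : ℕ} [NeZero n] (hpr : p ∣ r) {ξ : ℂ} (hξ : IsPrimitiveRoot ξ r)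
    {w : Fin n → ℤ} (hw01 : w 0 = w 1) (hw : (p : ℤ) ∣ ∑ j, w j) (hr : r ≠ 0) :
    monomialMatrix 1 (fun j => ξ ^ w j) ∈ Zg r p n (gOneMinusTwo r n ξ) := by
  have h0 := hξ.ne_zero hr
  refine monomialMatrix_mem_Zg (fun j => ?_) ?_ rfl rfl (by simp [hw01])
  · rw [← zpow_natCast, zpow_comm, zpow_natCast, hξ.pow_eq_one, _root_.one_zpow]
  · have : ∏ j, ξ ^ w j = ξ ^ ∑ j, w j := by
      induction (Finset.univ : Finset (Fin n)) using Finset.induction_on with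
      | empty => simp
      | insert a s ha ih => rw [Finset.prod_insert ha, Finset.sum_insert ha, ih, zpow_add₀ h0]
    obtain ⟨k, hk⟩ := hw
    rw [this, hk, ← zpow_natCast, ← _root_.zpow_mul, hξ.zpow_eq_one_iff_dvd]
    refine ⟨k, ?_⟩
    conv_rhs => rw [← Nat.mul_div_cancel' hpr]
    push_cast
    ring

lemma dvd_sum_of_invariant {r p n : ℕ} [NeZero n] (hpr : p ∣ r) {ξ : ℂ}
    (hξ : IsPrimitiveRoot ξ r) {f : MvPolynomial (Fin n) ℂ}
    (hf : ∀ h ∈ Zg r p n (gOneMinusTwo r n ξ), act h f = f)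
    {w : Fin n → ℤ} (hw01 : w 0 = w 1) (hw : (p : ℤ) ∣ ∑ j, w j) (hr : r ≠ 0)
    {e : Fin n →₀ ℕ} (he : e ∈ f.support) : (r : ℤ) ∣ ∑ j, w j * e j := by
  have h0 := hξ.ne_zero hr
  have := congrArg (coeff e) (hf _ (diagonal_mem_Zg hpr hξ hw01 hw hr))
  rw [coeff_act_diagonal] at this
  have h1 := mul_right_cancel₀ (mem_support_iff.1 he) (this.trans (one_mul _).symm)
  rw [← hξ.zpow_eq_one_iff_dvd, ← h1]
  induction (Finset.univ : Finset (Fin n)) using Finset.induction_on with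
  | empty => simp
  | insert a s ha ih =>
    rw [Finset.prod_insert ha, Finset.sum_insert ha, ← ih, zpow_add₀ h0, _root_.zpow_mul, zpow_natCast]

lemma invariants_of_one_minus_two_of_zero (p n : ℕ) [NeZero n] (ξ : ℂ) :
    {f : MvPolynomial (Fin n) ℂ |
        f ∈ SVg (gOneMinusTwo 0 n ξ) ∧
          ∀ h ∈ Zg 0 p n (gOneMinusTwo 0 n ξ), act h f = f}
      = ↑(Algebra.adjoin ℂ
          (insert (flast 0 p n ^ (if 2 ∣ p then p / 2 else p))
            ((fun i => fmid 0 n i) '' Set.Ico 1 (n - 2)))) := by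
  ext f
  constructor
  · rintro ⟨-, hf⟩
    have hmem : monomialMatrix 1 (fun _ : Fin n => (2 : ℂ)) ∈ Zg 0 p n (gOneMinusTwo 0 n ξ) :=
      monomialMatrix_mem_Zg (by simp) (by simp) rfl rfl rfl
    have hfC : f = C (coeff 0 f) := by
      ext e
      rw [coeff_C]
      split_ifs with he
      · rw [he]
      · by_contra hne
        have := congrArg (coeff e) (hf _ hmem)
        rw [coeff_act_diagonal] at this
        have h1 := mul_right_cancel₀ hne (this.trans (one_mul _).symm)
        rw [Finset.prod_pow_eq_pow_sum] at h1
        have h2 : (2 : ℕ) ^ (∑ j, e j) = 1 := by exact_mod_cast h1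
        have h3 : ∑ j, e j = 0 := by simpa using h2
        apply he
        ext j
        have := Finset.sum_eq_zero_iff.1 h3 j (Finset.mem_univ j)
        simp [this]
    rw [hfC]
    exact Subalgebra.algebraMap_mem _ _
  · intro hf
    have hle : Algebra.adjoin ℂ
          (insert (flast 0 p n ^ (if 2 ∣ p then p / 2 else p))
            ((fun i => fmid 0 n i) '' Set.Ico 1 (n - 2))) ≤ ⊥ := by
      refine Algebra.adjoin_le ?_
      rintro x (rfl | ⟨i, -, rfl⟩)
      · simp only [flast, Nat.zero_div, pow_zero, Finset.prod_const_one, one_pow]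
        exact Subalgebra.one_mem _
      · simp only [fmid, pow_zero, Finset.prod_const_one]
        exact Subalgebra.sum_mem _ fun _ _ => Subalgebra.one_mem _
    obtain ⟨c, rfl⟩ := Algebra.mem_bot.1 (hle hf)
    exact ⟨Subalgebra.algebraMap_mem _ c, fun h _ => AlgHom.commutes _ c⟩

lemma mem_invariants_of_mem_adjoin {r p n : ℕ} [NeZero n] (hn : 2 ≤ n) (hr : r ≠ 0)
    (hpr : p ∣ r) (hreven : 2 ∣ r) (hrpeven : 2 ∣ r / p) {ξ : ℂ} (hξ : IsPrimitiveRoot ξ r)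
    {f : MvPolynomial (Fin n) ℂ}
    (hf : f ∈ Algebra.adjoin ℂ
          (insert (flast r p n ^ (if 2 ∣ p then p / 2 else p))
            ((fun i => fmid r n i) '' Set.Ico 1 (n - 2)))) :
    f ∈ SVg (gOneMinusTwo r n ξ) ∧
      ∀ h ∈ Zg r p n (gOneMinusTwo r n ξ), act h f = f := by
  constructor
  · rw [SVg_gOneMinusTwo hn hr hreven hξ]
    refine Algebra.adjoin_le ?_ hf
    rintro x (rfl | ⟨i, -, rfl⟩)
    · rw [flast_pow]
      exact ⟨_, rfl⟩
    · exact ⟨_, rename_expand_esymm r n i⟩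
  · intro h hh
    obtain ⟨σ, d, rfl, hd, hψ, hσ, hd01⟩ := exists_of_mem_Zg hn hr hreven hξ hh
    suffices hle : Algebra.adjoin ℂ
          (insert (flast r p n ^ (if 2 ∣ p then p / 2 else p))
            ((fun i => fmid r n i) '' Set.Ico 1 (n - 2))) ≤
        AlgHom.equalizer (act (monomialMatrix σ d)) (AlgHom.id ℂ _) from hle hf
    refine Algebra.adjoin_le ?_
    rintro x (rfl | ⟨i, -, rfl⟩)
    · change act _ _ = _
      rw [flast_pow, map_pow, map_pow, act_rename_prod_X hσ, mul_pow, ← C_pow]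
      suffices hD : (∏ j : FixedIdx n, d j) ^ (r / p * if 2 ∣ p then p / 2 else p) = 1 by
        rw [hD]
        simp
      split_ifs with h2
      · obtain ⟨s, hs⟩ := hrpeven
        obtain ⟨m, rfl⟩ := h2
        have hrm : r = 4 * s * m := by
          rw [← Nat.div_mul_cancel hpr, hs]
          ring
        rw [hs, Nat.mul_div_cancel_left _ two_pos]
        rw [hs, prod_eq_mul_prod_fixedIdx hn, mul_pow] at hψ
        have h4 : (d 0 * d 1) ^ (2 * s) = d 0 ^ (4 * s) := by
          rw [pow_mul, mul_pow, ← hd01, ← pow_add, ← pow_mul]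
        have h5 := congrArg (· ^ m) hψ
        simp only [mul_pow, h4, one_pow, ← pow_mul] at h5
        rwa [← hrm, hd, one_mul] at h5
      · rw [Nat.div_mul_cancel hpr, ← Finset.prod_pow]
        simp [hd]
    · change act _ (fmid r n i) = fmid r n i
      rw [← rename_expand_esymm, act_rename_expand hd hσ, rename_esymm]

lemma mem_adjoin_of_mem_invariants {r p n : ℕ} [NeZero n] (hn : 3 ≤ n) (hr : r ≠ 0)
    (hpr : p ∣ r) (hreven : 2 ∣ r) {ξ : ℂ} (hξ : IsPrimitiveRoot ξ r)
    {f : MvPolynomial (Fin n) ℂ} (hfS : f ∈ SVg (gOneMinusTwo r n ξ))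
    (hf : ∀ h ∈ Zg r p n (gOneMinusTwo r n ξ), act h f = f) :
    f ∈ Algebra.adjoin ℂ
          (insert (flast r p n ^ (if 2 ∣ p then p / 2 else p))
            ((fun i => fmid r n i) '' Set.Ico 1 (n - 2))) := by
  have hn2 : 2 ≤ n := by omega
  have h01 := zero_ne_one_of_two_le hn2
  rw [SVg_gOneMinusTwo hn2 hr hreven hξ] at hfS
  obtain ⟨g, rfl⟩ := hfS
  change ∀ h ∈ _, act h (rename Subtype.val g) = rename Subtype.val g at hf
  change rename Subtype.val g ∈ _
  set a := if 2 ∣ p then p / 2 else p with ha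
  obtain ⟨m, b, hb, hma⟩ : ∃ (m : ℕ) (b : ℤ), (p : ℤ) ∣ 2 * b + m ∧ p = m * a := by
    by_cases h2 : 2 ∣ p
    · refine ⟨2, -1, by simp, ?_⟩
      rw [ha, if_pos h2, Nat.mul_div_cancel' h2]
    · refine ⟨1, p / 2, ?_, by rw [ha, if_neg h2, one_mul]⟩
      rw [show (2 * (p / 2 : ℤ) + (1 : ℕ)) = p by omega]
  set q := r / p * a with hq
  have hqm : r = m * q := by
    rw [hq, mul_left_comm, ← hma, Nat.div_mul_cancel hpr]
  have hm0 : m ≠ 0 := by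
    rintro rfl
    simp at hqm
    exact hr hqm
  have hsymm : g.IsSymmetric := by
    intro τ
    apply rename_injective _ Subtype.val_injective
    have hmem : monomialMatrix (Equiv.Perm.ofSubtype τ) (fun _ : Fin n => (1 : ℂ)) ∈
        Zg r p n (gOneMinusTwo r n ξ) := by
      refine monomialMatrix_mem_Zg (by simp) (by simp) ?_ ?_ rfl
      · exact Equiv.Perm.ofSubtype_apply_of_not_mem τ (by simp)
      · exact Equiv.Perm.ofSubtype_apply_of_not_mem τ (by rw [val_one_of_two_le hn2]; simp)
    have key : act (monomialMatrix (Equiv.Perm.ofSubtype τ) (fun _ : Fin n => (1 : ℂ))) =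
        rename (Equiv.Perm.ofSubtype τ) := by
      ext1 j
      rw [act_monomialMatrix_X, rename_X, C_1, one_mul]
    have := hf _ hmem
    rw [key, rename_rename] at this
    have hcomp : (Subtype.val ∘ τ : FixedIdx n → Fin n) =
        Equiv.Perm.ofSubtype τ ∘ Subtype.val :=
      funext fun j => (Equiv.Perm.ofSubtype_apply_coe τ j).symm
    rw [rename_rename, hcomp, this]
  have hsupp : ∀ u ∈ g.support, ∃ (c : ℕ) (k : FixedIdx n →₀ ℕ), ∀ j, u j = q * c + r * k j := by
    intro u hu
    set e : Fin n →₀ ℕ := u.mapDomain Subtype.val with he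
    have hee : e ∈ (rename (Subtype.val : FixedIdx n → Fin n) g).support := by
      rw [mem_support_iff, he, coeff_rename_mapDomain _ Subtype.val_injective]
      exact mem_support_iff.1 hu
    have hej : ∀ j : FixedIdx n, e j = u j := fun j =>
      Finsupp.mapDomain_apply Subtype.val_injective u j
    have he0 : ∀ t : Fin n, ¬ 2 ≤ (t : ℕ) → e t = 0 := fun t ht =>
      Finsupp.mapDomain_of_notMem_range u t (by simpa using ht)
    have e0 : e 0 = 0 := he0 0 (by simp)
    have e1 : e 1 = 0 := he0 1 (by rw [val_one_of_two_le hn2]; simp)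
    have hdiff : ∀ i j : FixedIdx n, (r : ℤ) ∣ u i - u j := by
      intro i j
      obtain ⟨i0, i1⟩ := (two_le_val_iff hn2 i.1).1 i.2
      obtain ⟨j0, j1⟩ := (two_le_val_iff hn2 j.1).1 j.2
      have := dvd_sum_of_invariant hpr hξ hf (w := Pi.single i.1 1 - Pi.single j.1 1)
        (by simp [i0.symm, i1.symm, j0.symm, j1.symm]) (by simp) hr hee
      simpa [sub_mul, Pi.single_apply, hej] using this
    have hdvd : ∀ i : FixedIdx n, q ∣ u i := by
      intro i
      obtain ⟨i0, i1⟩ := (two_le_val_iff hn2 i.1).1 i.2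
      have := dvd_sum_of_invariant hpr hξ hf
        (w := Pi.single 0 b + Pi.single 1 b + Pi.single i.1 (m : ℤ))
        (by simp [i0.symm, i1.symm, h01, h01.symm])
        (by simpa [Finset.sum_add_distrib, two_mul] using hb) hr hee
      have h3 : (r : ℤ) ∣ m * u i := by
        simpa [add_mul, Finset.sum_add_distrib, Pi.single_apply, hej, e0, e1] using this
      have h4 : m * q ∣ m * u i := by
        rw [← hqm]
        exact_mod_cast h3
      exact Nat.dvd_of_mul_dvd_mul_left (Nat.pos_of_ne_zero hm0) h4
    let j₀ : FixedIdx n := ⟨⟨2, hn⟩, le_rfl⟩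
    have hmod : ∀ j, u j % r = u j₀ % r := fun j =>
      ((Nat.modEq_iff_dvd).2 (hdiff j₀ j) : u j ≡ u j₀ [MOD r])
    obtain ⟨c, hc⟩ : q ∣ u j₀ % r :=
      (Nat.dvd_mod_iff (hqm ▸ Dvd.intro_left m rfl)).2 (hdvd j₀)
    refine ⟨c, Finsupp.equivFunOnFinite.symm fun j => u j / r, fun j => ?_⟩
    rw [← hc, ← hmod j]
    exact (Nat.mod_add_div _ _).symm
  have hg := hsymm.mem_adjoin_of_support hsupp
  have hg' : rename Subtype.val g ∈ (Algebra.adjoin ℂ (insert ((∏ j, X j) ^ q)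
      ((fun i => expand r (esymm (FixedIdx n) ℂ i)) ''
        Set.Ico 1 (Fintype.card (FixedIdx n) + 1)))).map
      (rename (Subtype.val : FixedIdx n → Fin n)) := ⟨g, hg, rfl⟩
  rw [AlgHom.map_adjoin] at hg'
  refine Algebra.adjoin_le ?_ hg'
  have hP : rename Subtype.val ((∏ j : FixedIdx n, (X j : MvPolynomial _ ℂ)) ^ q) ∈
      Algebra.adjoin ℂ (insert (flast r p n ^ a)
            ((fun i => fmid r n i) '' Set.Ico 1 (n - 2))) := by
    rw [hq, ← flast_pow]
    exact Algebra.subset_adjoin (Set.mem_insert _ _)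
  have hcard : Fintype.card (FixedIdx n) = n - 2 := by
    have h2 : (Finset.univ.filter fun t : Fin n => 2 ≤ (t : ℕ)) = {0, 1}ᶜ := by
      ext t
      simp [two_le_val_iff hn2]
    rw [← Finset.card_univ, ← Finset.card_map (Function.Embedding.subtype _),
      map_subtype_univ_fixedIdx, h2, Finset.card_compl, Finset.card_pair h01, Fintype.card_fin]
  rintro _ ⟨_, rfl | ⟨i, ⟨hi1, hi2⟩, rfl⟩, rfl⟩
  · exact hP
  · by_cases hi : i < n - 2
    · refine Algebra.subset_adjoin (Or.inr ⟨i, ⟨hi1, hi⟩, ?_⟩)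
      exact (rename_expand_esymm r n i).symm
    · have hi' : i = Fintype.card (FixedIdx n) := by omega
      have : expand r (esymm (FixedIdx n) ℂ i) = ((∏ j, X j) ^ q) ^ m := by
        rw [hi', esymm, ← Finset.card_univ, Finset.powersetCard_self, Finset.sum_singleton,
          map_prod, ← pow_mul, mul_comm q, ← hqm, ← Finset.prod_pow]
        simp
      change rename Subtype.val (expand r (esymm (FixedIdx n) ℂ i)) ∈ _
      rw [this, map_pow]
      exact Subalgebra.pow_mem _ hP _

/-- Assume `n ≥ 4`, `r` even, `r/p` even, and let `G = G(r,p,n)` and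
`g = (1,−2) = ξ₂^{r/2}(1,2) ∈ G(r,p,n)`.  With `n' = n−2`, `f_i = e_i(v₃^r,…,v_n^r)` for
`1 ≤ i ≤ n'−1` and `f_{n'} = (v₃⋯v_n)^{r/p}`, the invariant ring is
`S(V^g)^{Z(g)} = ℂ[f₁,…,f_{n'−1}, f_{n'}^{p/2}]` if `p` is even and
`ℂ[f₁,…,f_{n'−1}, f_{n'}^{p}]` if `p` is odd. -/
theorem invariants_of_one_minus_two_in_Grpn
    (r p n : ℕ) [NeZero n] (hn : 4 ≤ n) (hp : 0 < p) (hpr : p ∣ r)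
    (hreven : 2 ∣ r) (hrpeven : 2 ∣ r / p)
    (ξ : ℂ) (hξ : IsPrimitiveRoot ξ r) :
    {f : MvPolynomial (Fin n) ℂ |
        f ∈ SVg (gOneMinusTwo r n ξ) ∧
          ∀ h ∈ Zg r p n (gOneMinusTwo r n ξ), act h f = f}
      = ↑(Algebra.adjoin ℂ
          (insert (flast r p n ^ (if 2 ∣ p then p / 2 else p))
            ((fun i => fmid r n i) '' Set.Ico 1 (n - 2)))) := by
  rcases eq_or_ne r 0 with rfl | hr
  · exact invariants_of_one_minus_two_of_zero p n ξ
  · ext f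
    exact ⟨fun h => mem_adjoin_of_mem_invariants (by omega) hr hpr hreven hξ h.1 h.2,
      fun h => mem_invariants_of_mem_adjoin (by omega) hr hpr hreven hrpeven hξ h⟩

end
end

section
/- Assume n ≥ 2, r ≥ 2, p < r, and let G = G(r,p,n). Let g = ξ_1^{ℓ_1} ξ_2^{ℓ_2} with ℓ_1 ≢ 0 (mod r), ℓ_2 ≢ 0 (mod r), and p dividing ℓ_1 + ℓ_2 (so that g ∈ G(r,p,n)). Then the χ_g-semi-invariants vanish: S(V^g)^{χ_g} = 0. -/
open MvPolynomial Matrix Finset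

attribute [local instance] Classical.propDecidable

noncomputable section

/-- If `f x - x ∈ W` for all `x`, then `W` is stable under `f` and `f` has the same determinant
on `W` as on the whole space. -/
theorem detOn_eq_det {n : ℕ} (f : EuclideanSpace ℂ (Fin n) →ₗ[ℂ] EuclideanSpace ℂ (Fin n))
    (W : Submodule ℂ (EuclideanSpace ℂ (Fin n))) (hf : ∀ x, f x - x ∈ W) :
    detOn f W = LinearMap.det f := by
  have hW : ∀ x ∈ W, f x ∈ W := fun x hx => by simpa using W.add_mem (hf x) hx
  have hQ : W.mapQ W f hW = LinearMap.id := by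
    ext x
    simpa [Submodule.Quotient.eq] using hf x
  rw [detOn, dif_pos hW, LinearMap.det_eq_det_mul_det W f hW, hQ, LinearMap.det_id, mul_one]

/-- A diagonal matrix of `r`-th roots of unity whose determinant is an `r/p`-th root of unity
lies in the centralizer of every diagonal matrix. -/
theorem diagonal_mem_Zg_s5 {r p n : ℕ} (d e : Fin n → ℂ) (hd : ∀ j, d j ^ r = 1)
    (hdet : (∏ j, d j) ^ (r / p) = 1) : diagonal d ∈ Zg r p n (diagonal e) := by
  refine ⟨⟨⟨1, d, hd, fun i j => ?_⟩, ?_⟩, ?_⟩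
  · by_cases h : i = j <;> simp [h]
  · simpa [diagonal_apply] using hdet
  · simp only [diagonal_mul_diagonal, mul_comm]

/-- The diagonal matrix of `d` acts trivially on `S(V^g)`, for `g` the diagonal matrix of `e`,
when `d j = 1` wherever `e j = 1`. -/
theorem act_diagonal_of_mem_SVg {n : ℕ} (d e : Fin n → ℂ) (h : ∀ j, e j = 1 → d j = 1)
    {f : MvPolynomial (Fin n) ℂ} (hf : f ∈ SVg (diagonal e)) : act (diagonal d) f = f := by
  suffices SVg (diagonal e) ≤ AlgHom.equalizer (act (diagonal d)) (AlgHom.id ℂ _) from this hf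
  refine Algebra.adjoin_le ?_
  rintro _ ⟨c, hc, rfl⟩
  simp only [SetLike.mem_coe, AlgHom.mem_equalizer, AlgHom.id_apply, map_sum, map_mul]
  refine Finset.sum_congr rfl fun j _ => ?_
  have hcj : e j * c j = c j := by simpa [mulVec_diagonal] using congrFun hc j
  have hX : act (diagonal d) (X j) = C (d j) * X j := by
    simp [act, diagonal_apply, apply_ite C, ite_mul]
  rw [hX, ← algebraMap_eq, AlgHom.commutes]
  rcases eq_or_ne (c j) 0 with h0 | h0
  · simp [h0]
  · simp [h j (by simpa [h0] using hcj)]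

/-- The Hochschild character of a diagonal `g` at a diagonal matrix that is trivial on `V^g` is
the determinant. -/
theorem chi_diagonal {n : ℕ} (d e : Fin n → ℂ) (h : ∀ j, e j = 1 → d j = 1) :
    chi (diagonal e) (diagonal d) = ∏ j, d j := by
  rw [chi, detOn_eq_det]
  · rw [toEuclideanLin, toLpLin_eq_toLin, LinearMap.det_toLin, det_diagonal]
  · intro x
    rw [Submodule.mem_orthogonal]
    intro u hu
    rw [PiLp.inner_apply]
    refine Finset.sum_eq_zero fun j _ => ?_
    have hu' : toEuclideanLin (diagonal e) u = u := by
      simpa [fixedSpace, sub_eq_zero] using hu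
    have huj : e j * u j = u j := by
      simpa [toLpLin_apply, mulVec_diagonal] using congrArg (fun v => v j) hu'
    rcases eq_or_ne (u j) 0 with h0 | h0
    · simp [h0]
    · simp [toLpLin_apply, mulVec_diagonal, h j (by simpa [h0] using huj)]

/-- Assume `n ≥ 2`, `r ≥ 2`, `p < r` (with `p ∣ r`), and let
`G = G(r,p,n)`.  Let `g = ξ₁^{ℓ₁} ξ₂^{ℓ₂}` with `ℓ₁ ≢ 0 (mod r)`, `ℓ₂ ≢ 0 (mod r)`, and
`p ∣ ℓ₁ + ℓ₂` (so that `g ∈ G(r,p,n)`).  Then the `χ_g`-semi-invariants vanish: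
`S(V^g)^{χ_g} = 0`. -/
theorem semiinvariants_vanish_diagonal_case
    (r p n : ℕ) [NeZero n] (hn : 2 ≤ n) (hr : 2 ≤ r) (hp : 0 < p) (hpr : p ∣ r)
    (hplt : p < r) (ξ : ℂ) (hξ : IsPrimitiveRoot ξ r)
    (ℓ₁ ℓ₂ : ℕ) (h1 : ¬ r ∣ ℓ₁) (h2 : ¬ r ∣ ℓ₂) (hsum : p ∣ ℓ₁ + ℓ₂)
    (g : Matrix (Fin n) (Fin n) ℂ)
    (hg : g = Matrix.diagonal fun t : Fin n =>
        if t = 0 then ξ ^ ℓ₁ else if t = 1 then ξ ^ ℓ₂ else 1) :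
    ∀ f ∈ SVg g, (∀ h ∈ Zg r p n g, act h f = chi g h • f) → f = 0 := by
  subst hg
  intro f hf hsemi
  set e : Fin n → ℂ := fun t => if t = 0 then ξ ^ ℓ₁ else if t = 1 then ξ ^ ℓ₂ else 1 with he
  set d : Fin n → ℂ := fun t => if t = 0 then ξ ^ p else 1 with hd
  have hprod : ∏ j, d j = ξ ^ p := by simp [hd]
  have hde : ∀ j, e j = 1 → d j = 1 := by
    intro j hj
    by_cases h0 : j = 0
    · exact absurd ((hξ.pow_eq_one_iff_dvd ℓ₁).1 (by simpa [he, h0] using hj)) h1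
    · simp [hd, h0]
  have hmem : diagonal d ∈ Zg r p n (diagonal e) := by
    refine diagonal_mem_Zg_s5 d e (fun j => ?_) ?_
    · by_cases h0 : j = 0
      · simp [hd, h0, pow_right_comm ξ p r, hξ.pow_eq_one]
      · simp [hd, h0]
    · rw [hprod, ← pow_mul, Nat.mul_div_cancel' hpr, hξ.pow_eq_one]
  have key := hsemi _ hmem
  rw [act_diagonal_of_mem_SVg d e hde hf, chi_diagonal d e hde, hprod] at key
  have hne : ξ ^ p - 1 ≠ 0 := sub_ne_zero.2 (hξ.pow_ne_one_of_pos_of_lt hp.ne' hplt)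
  refine (smul_eq_zero.1 (?_ : (ξ ^ p - 1) • f = 0)).resolve_left hne
  rw [sub_smul, one_smul, ← key, sub_self]

end
end

section
/- Assume n ≥ 2 and r ≥ 2 is even, and let G = G(r,r,n) and g = ξ_1^{r/2} ξ_2^{r/2} ∈ G(r,r,n). Then the χ_g-semi-invariants vanish: S(V^g)^{χ_g} = 0. -/
open MvPolynomial Matrix Finset

attribute [local instance] Classical.propDecidable

noncomputable section

/-- The monomial matrix of the transposition `(a b)`. -/
def swapMatrix {n : ℕ} (a b : Fin n) : Matrix (Fin n) (Fin n) ℂ :=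
  Matrix.of fun i j => if i = Equiv.swap a b j then 1 else 0

theorem swapMatrix_apply {n : ℕ} (a b i j : Fin n) :
    swapMatrix a b i j = if i = Equiv.swap a b j then 1 else 0 := rfl

theorem swapMatrix_apply' {n : ℕ} (a b i j : Fin n) :
    swapMatrix a b i j = if j = Equiv.swap a b i then 1 else 0 := by
  rw [swapMatrix_apply]
  congr 1
  rw [eq_iff_iff, eq_comm, Equiv.swap_apply_eq_iff]

theorem swapMatrix_mulVec {n : ℕ} (a b : Fin n) (x : Fin n → ℂ) (i : Fin n) :
    (swapMatrix a b).mulVec x i = x (Equiv.swap a b i) := by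
  simp [Matrix.mulVec, dotProduct, swapMatrix_apply']

theorem swapMatrix_mem_GG (r p : ℕ) {n : ℕ} (a b : Fin n) : swapMatrix a b ∈ GG r p n := by
  refine ⟨⟨Equiv.swap a b, fun _ => 1, by simp, fun i j => rfl⟩, ?_⟩
  simp [swapMatrix_apply']

theorem swapMatrix_mul_diagonal {n : ℕ} {a b : Fin n} {d : Fin n → ℂ} (hd : d a = d b) :
    swapMatrix a b * Matrix.diagonal d = Matrix.diagonal d * swapMatrix a b := by
  ext i j
  rw [Matrix.mul_diagonal, Matrix.diagonal_mul, swapMatrix_apply', mul_comm]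
  split_ifs with h
  · have : d j = d i := by
      rw [h, Equiv.swap_apply_def]
      split_ifs with h₁ h₂ <;> simp_all
    rw [this]
  · simp

theorem act_swapMatrix_X {n : ℕ} (a b j : Fin n) :
    act (swapMatrix a b) (X j) = X (Equiv.swap a b j) := by
  simp [act, swapMatrix_apply, apply_ite]

/-- If every vector fixed by `g` vanishes at `a` and `b`, then `(a b)` acts trivially on
`S(V^g)`. -/
theorem act_swapMatrix_of_mem_SVg {n : ℕ} {a b : Fin n} {g : Matrix (Fin n) (Fin n) ℂ}
    (hg : ∀ c, g.mulVec c = c → c a = 0 ∧ c b = 0) {f : MvPolynomial (Fin n) ℂ}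
    (hf : f ∈ SVg g) : act (swapMatrix a b) f = f := by
  have hle : SVg g ≤ AlgHom.equalizer (act (swapMatrix a b)) (AlgHom.id ℂ _) := by
    refine Algebra.adjoin_le ?_
    rintro _ ⟨c, hc, rfl⟩
    obtain ⟨ha, hb⟩ := hg c hc
    change act _ _ = ∑ i, C (c i) * X i
    rw [map_sum]
    refine Finset.sum_congr rfl fun i _ => ?_
    rw [map_mul, act_swapMatrix_X, ← MvPolynomial.algebraMap_eq, AlgHom.commutes]
    by_cases hia : i = a
    · simp [hia, ha]
    by_cases hib : i = b
    · simp [hib, hb]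
    rw [Equiv.swap_apply_of_ne_of_ne hia hib]
  exact hle hf

/-- If every vector fixed by `g` vanishes at `a` and `b`, then the Hochschild character of `g`
takes the value `-1` at `(a b)`. -/
theorem chi_swapMatrix {n : ℕ} {a b : Fin n} (hab : a ≠ b) {g : Matrix (Fin n) (Fin n) ℂ}
    (hg : ∀ c, g.mulVec c = c → c a = 0 ∧ c b = 0) : chi g (swapMatrix a b) = -1 := by
  let v : EuclideanSpace ℂ (Fin n) := EuclideanSpace.single a 1 - EuclideanSpace.single b 1
  have hv : v ∈ (fixedSpace g)ᗮ := by
    rw [Submodule.mem_orthogonal]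
    intro y hy
    have hy' : g.mulVec y.ofLp = y.ofLp := by
      have h := sub_eq_zero.mp (LinearMap.mem_ker.mp hy)
      exact congrArg WithLp.ofLp h
    obtain ⟨ha, hb⟩ := hg _ hy'
    simp [v, inner_sub_right, EuclideanSpace.inner_single_right, ha, hb]
  let φ : EuclideanSpace ℂ (Fin n) →ₗ[ℂ] ℂ :=
    (EuclideanSpace.proj b : EuclideanSpace ℂ (Fin n) →L[ℂ] ℂ).toLinearMap -
      (EuclideanSpace.proj a : EuclideanSpace ℂ (Fin n) →L[ℂ] ℂ).toLinearMap
  have hswap (x : EuclideanSpace ℂ (Fin n)) :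
      Matrix.toEuclideanLin (swapMatrix a b) x = x + φ x • v := by
    ext i
    change (swapMatrix a b).mulVec x.ofLp i = _
    rw [swapMatrix_mulVec, Equiv.swap_apply_def]
    by_cases hia : i = a
    · subst hia
      simp [φ, v, hab]
    by_cases hib : i = b
    · subst hib
      simp [φ, v, hia]
    simp [φ, v, hia, hib]
  have hinv : ∀ x ∈ (fixedSpace g)ᗮ,
      Matrix.toEuclideanLin (swapMatrix a b) x ∈ (fixedSpace g)ᗮ := by
    intro x hx
    rw [hswap]
    exact add_mem hx (Submodule.smul_mem _ _ hv)
  have hres : (Matrix.toEuclideanLin (swapMatrix a b)).restrict hinv =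
      LinearMap.transvection (φ ∘ₗ (fixedSpace g)ᗮ.subtype) ⟨v, hv⟩ := by
    ext1 x
    apply Subtype.ext
    exact hswap x
  rw [chi, detOn, dif_pos hinv, hres, LinearMap.transvection.det]
  simp [φ, v, hab, hab.symm]

/-- Assume `n ≥ 2` and `r ≥ 2` is even, and let `G = G(r,r,n)` and
`g = ξ₁^{r/2} ξ₂^{r/2} ∈ G(r,r,n)`.  Then the `χ_g`-semi-invariants vanish:
`S(V^g)^{χ_g} = 0`. -/
theorem semiinvariants_vanish_minus_one_diagonal_case
    (r n : ℕ) [NeZero n] (hn : 2 ≤ n) (hr : 2 ≤ r) (hreven : 2 ∣ r)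
    (ξ : ℂ) (hξ : IsPrimitiveRoot ξ r)
    (g : Matrix (Fin n) (Fin n) ℂ)
    (hg : g = Matrix.diagonal fun t : Fin n =>
        if t = 0 then ξ ^ (r / 2) else if t = 1 then ξ ^ (r / 2) else 1) :
    ∀ f ∈ SVg g, (∀ h ∈ Zg r r n g, act h f = chi g h • f) → f = 0 := by
  obtain ⟨k, rfl⟩ := hreven
  have hk : 2 * k / 2 = k := by omega
  have hξk : ξ ^ k = -1 := by
    have hne : ξ ^ k ≠ 1 := hξ.pow_ne_one_of_pos_of_lt (by omega) (by omega)
    have hsq : (ξ ^ k) ^ 2 = 1 := by rw [← pow_mul, mul_comm, hξ.pow_eq_one]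
    exact (mul_self_eq_one_iff.mp (by rw [← sq, hsq])).resolve_left hne
  have h01 : (0 : Fin n) ≠ 1 := by
    obtain ⟨m, rfl⟩ := Nat.exists_eq_add_of_le' hn
    exact Fin.zero_ne_one
  rw [hk, hξk] at hg
  have hfix : ∀ c, g.mulVec c = c → c 0 = 0 ∧ c 1 = 0 := by
    intro c hc
    have h0 := congrFun hc 0
    have h1 := congrFun hc 1
    rw [hg, Matrix.mulVec_diagonal] at h0 h1
    simp only [if_true, h01.symm, if_false, neg_one_mul, neg_eq_self] at h0 h1
    exact ⟨h0, h1⟩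
  intro f hf hsemi
  have hcomm : swapMatrix (0 : Fin n) 1 * g = g * swapMatrix 0 1 := by
    rw [hg]
    exact swapMatrix_mul_diagonal (by simp)
  have h := hsemi _ ⟨swapMatrix_mem_GG _ _ 0 1, hcomm⟩
  rw [act_swapMatrix_of_mem_SVg hfix hf, chi_swapMatrix h01 hfix, neg_one_smul] at h
  exact self_eq_neg.mp h

end
end

section
/- Assume n ≥ 3 and r ≥ 2, and let G = G(r,p,n) and g = (1,2)·ξ_3^{ℓ} with ℓ ≢ 0 (mod r) and p dividing ℓ (so that g ∈ G(r,p,n)). Then the χ_g-semi-invariants vanish: S(V^g)^{χ_g} = 0. -/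
open MvPolynomial Matrix Finset

attribute [local instance] Classical.propDecidable

noncomputable section

/-- A diagonal reflection `diag(1, …, ω, …, 1)` acts on a subspace containing the `k`-th basis
vector with determinant `ω`. -/
theorem detOn_diagonal_update {n : ℕ} (k : Fin n) (ω : ℂ)
    (W : Submodule ℂ (EuclideanSpace ℂ (Fin n))) (hW : EuclideanSpace.single k (1 : ℂ) ∈ W) :
    detOn (Matrix.toEuclideanLin (Matrix.diagonal (Function.update 1 k ω))) W = ω := by
  have key : ∀ x : EuclideanSpace ℂ (Fin n),
      Matrix.toEuclideanLin (Matrix.diagonal (Function.update 1 k ω)) x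
        = x + ((ω - 1) * x k) • EuclideanSpace.single k (1 : ℂ) := by
    intro x
    ext i
    by_cases hi : i = k
    · subst hi
      simp [Matrix.toLpLin_apply, Matrix.mulVec_diagonal]
      ring
    · simp [Matrix.toLpLin_apply, Matrix.mulVec_diagonal, hi]
  have hinv : ∀ x ∈ W,
      Matrix.toEuclideanLin (Matrix.diagonal (Function.update 1 k ω)) x ∈ W := by
    intro x hx
    rw [key]
    exact W.add_mem hx (W.smul_mem _ hW)
  rw [detOn, dif_pos hinv]
  let φ : Module.Dual ℂ W :=
    (ω - 1) • ((EuclideanSpace.proj k : EuclideanSpace ℂ (Fin n) →L[ℂ] ℂ).toLinearMap ∘ₗ W.subtype)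
  have hφ : (Matrix.toEuclideanLin (Matrix.diagonal (Function.update 1 k ω))).restrict hinv
      = LinearMap.transvection φ ⟨EuclideanSpace.single k 1, hW⟩ := by
    ext1 x
    apply Subtype.ext
    rw [LinearMap.restrict_apply, LinearMap.transvection.apply]
    simpa [φ] using key x
  rw [hφ, LinearMap.transvection.det]
  simp [φ]

/-- The matrix `diag(1, …, ω, …, 1)` fixes `S(V^g)` pointwise if every vector of `V^g` has
vanishing `k`-th coordinate. -/
theorem act_diagonal_update_of_mem_SVg {n : ℕ} (k : Fin n) (ω : ℂ)
    (g : Matrix (Fin n) (Fin n) ℂ) (hg : ∀ c : Fin n → ℂ, g.mulVec c = c → c k = 0)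
    {f : MvPolynomial (Fin n) ℂ} (hf : f ∈ SVg g) :
    act (Matrix.diagonal (Function.update 1 k ω)) f = f := by
  have hle : SVg g ≤ AlgHom.equalizer (act (Matrix.diagonal (Function.update 1 k ω)))
      (AlgHom.id ℂ (MvPolynomial (Fin n) ℂ)) := by
    refine Algebra.adjoin_le ?_
    rintro q ⟨c, hc, rfl⟩
    change act _ _ = _
    rw [map_sum]
    refine Finset.sum_congr rfl fun i _ => ?_
    by_cases hi : i = k
    · simp [hi, hg c hc]
    · simp [act, Matrix.diagonal_apply, hi, algHom_C, apply_ite C, ite_mul]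
  exact hle hf

/-- Assume `n ≥ 3` and `r ≥ 2`, and let `G = G(r,p,n)` and
`g = (1,2)·ξ₃^ℓ` with `ℓ ≢ 0 (mod r)` and `p ∣ ℓ` (so that `g ∈ G(r,p,n)`).
Then the `χ_g`-semi-invariants vanish: `S(V^g)^{χ_g} = 0`. -/
theorem semiinvariants_vanish_transposition_times_diagonal
    (r p n : ℕ) [NeZero n] (hn : 3 ≤ n) (hr : 2 ≤ r) (hp : 0 < p) (hpr : p ∣ r)
    (ξ : ℂ) (hξ : IsPrimitiveRoot ξ r)
    (ℓ : ℕ) (hℓ : ¬ r ∣ ℓ) (hpℓ : p ∣ ℓ)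
    (g : Matrix (Fin n) (Fin n) ℂ)
    (hg : g = Matrix.of fun i j : Fin n =>
        if i = Equiv.swap (0 : Fin n) 1 j then (if j = 2 then ξ ^ ℓ else 1) else 0) :
    ∀ f ∈ SVg g, (∀ h ∈ Zg r p n g, act h f = chi g h • f) → f = 0 := by
  have hn2 : ((2 : Fin n) : ℕ) = 2 := by
    simp [Nat.mod_eq_of_lt (show 2 < n by omega)]
  have hn1 : ((1 : Fin n) : ℕ) = 1 := by
    simp [Nat.mod_eq_of_lt (show 1 < n by omega)]
  have h20 : (2 : Fin n) ≠ 0 := fun h => by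
    have := congrArg Fin.val h
    rw [hn2, Fin.val_zero] at this
    omega
  have h21 : (2 : Fin n) ≠ 1 := fun h => by
    have := congrArg Fin.val h
    omega
  have hswap : Equiv.swap (0 : Fin n) 1 2 = 2 := Equiv.swap_apply_of_ne_of_ne h20 h21
  have hω : ξ ^ ℓ ≠ 1 := fun h => hℓ ((hξ.pow_eq_one_iff_dvd ℓ).1 h)
  have hrow : ∀ j : Fin n, 2 = Equiv.swap (0 : Fin n) 1 j ↔ j = 2 := by
    intro j
    rw [eq_comm, Equiv.swap_apply_eq_iff, hswap]
  have hfix : ∀ c : Fin n → ℂ, g.mulVec c = c → c 2 = 0 := by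
    intro c hc
    have h2 := congrFun hc 2
    simp only [hg, Matrix.mulVec, dotProduct, Matrix.of_apply, hrow] at h2
    simp only [ite_mul, zero_mul, Finset.sum_ite_eq', Finset.mem_univ, if_true] at h2
    have : (ξ ^ ℓ - 1) * c 2 = 0 := by linear_combination h2
    exact (mul_eq_zero.1 this).resolve_left (sub_ne_zero.2 hω)
  intro f hf hsemi
  have hmem : Matrix.diagonal (Function.update 1 2 (ξ ^ ℓ)) ∈ Zg r p n g := by
    refine ⟨⟨⟨1, Function.update 1 2 (ξ ^ ℓ), fun j => ?_, fun i j => ?_⟩, ?_⟩, ?_⟩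
    · by_cases hj : j = 2
      · rw [hj, Function.update_self, ← pow_mul, mul_comm, pow_mul, hξ.pow_eq_one, one_pow]
      · simp [hj]
    · by_cases hij : i = j
      · simp [hij]
      · simp [hij]
    · have hsum : ∀ i : Fin n,
          ∑ j, Matrix.diagonal (Function.update (1 : Fin n → ℂ) 2 (ξ ^ ℓ)) i j
            = Function.update (1 : Fin n → ℂ) 2 (ξ ^ ℓ) i := by
        intro i
        simp [Matrix.diagonal_apply]
      simp only [hsum]
      rw [Finset.prod_update_of_mem (Finset.mem_univ _)]
      obtain ⟨m, rfl⟩ := hpℓ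
      simp only [Pi.one_apply, Finset.prod_const_one, mul_one]
      rw [← pow_mul, mul_right_comm, Nat.mul_div_cancel' hpr, pow_mul, hξ.pow_eq_one, one_pow]
    · ext i j
      rw [Matrix.diagonal_mul, Matrix.mul_diagonal, hg, Matrix.of_apply]
      by_cases hij : i = Equiv.swap (0 : Fin n) 1 j
      · by_cases hj : j = 2
        · subst hj
          rw [hswap] at hij
          subst hij
          exact mul_comm _ _
        · have hi : i ≠ 2 := fun h => hj ((hrow j).1 (h ▸ hij))
          simp [hi, hj]
      · simp [hij]
  have hperp : EuclideanSpace.single (2 : Fin n) (1 : ℂ) ∈ (fixedSpace g)ᗮ := by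
    rw [Submodule.mem_orthogonal']
    intro u hu
    have hu' : g.mulVec u.ofLp = u.ofLp := by
      have := sub_eq_zero.1 (LinearMap.mem_ker.1 hu)
      exact congrArg WithLp.ofLp this
    simp [EuclideanSpace.inner_single_left, hfix _ hu']
  have h := hsemi _ hmem
  rw [act_diagonal_update_of_mem_SVg 2 _ g hfix hf, chi, detOn_diagonal_update 2 _ _ hperp] at h
  have h0 : (1 - ξ ^ ℓ) • f = 0 := by rw [sub_smul, one_smul, ← h, sub_self]
  exact (smul_eq_zero.1 h0).resolve_left (sub_ne_zero.2 hω.symm)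

end
end

section
/- Assume n ≥ 4 and let G = G(r,p,n) and g = (1,2)·ξ_3^{a}ξ_4^{−a}·(3,4) for any integer a (note g ∈ G(r,p,n) automatically). Then the χ_g-semi-invariants vanish: S(V^g)^{χ_g} = 0. -/
open MvPolynomial Matrix Finset

attribute [local instance] Classical.propDecidable

noncomputable section

theorem toEuclideanLin_swap_eq_transvection {n : ℕ} (i j : Fin n)
    (x : EuclideanSpace ℂ (Fin n)) :
    Matrix.toEuclideanLin (Matrix.swap ℂ i j) x =
      x + (x i - x j) • (EuclideanSpace.single j 1 - EuclideanSpace.single i 1) := by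
  ext k
  simp only [Matrix.ofLp_toLpLin, Matrix.toLin'_apply, Matrix.swap_mulVec, Function.comp_apply,
    Equiv.swap_apply_def, PiLp.add_apply, PiLp.smul_apply, PiLp.sub_apply,
    PiLp.single_apply, smul_eq_mul]
  split_ifs <;> simp_all

/-- If `V^g` lies in the hyperplane `x_i = x_j`, then the transposition `(i, j)` acts on
`(V^g)^⊥` as a reflection. -/
theorem chi_swap {n : ℕ} {i j : Fin n} (hij : i ≠ j) {g : Matrix (Fin n) (Fin n) ℂ}
    (hg : ∀ c : Fin n → ℂ, g.mulVec c = c → c i = c j) :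
    chi g (Matrix.swap ℂ i j) = -1 := by
  set v : EuclideanSpace ℂ (Fin n) := EuclideanSpace.single j 1 - EuclideanSpace.single i 1 with hv
  have hvW : v ∈ (fixedSpace g)ᗮ := by
    rw [Submodule.mem_orthogonal']
    intro u hu
    have hu' : g.mulVec u.ofLp = u.ofLp := by
      simpa [fixedSpace, sub_eq_zero, Matrix.toLpLin_apply, WithLp.ext_iff] using hu
    simp [hv, inner_sub_left, EuclideanSpace.inner_single_left, hg _ hu']
  have hinv : ∀ x ∈ (fixedSpace g)ᗮ,
      Matrix.toEuclideanLin (Matrix.swap ℂ i j) x ∈ (fixedSpace g)ᗮ := by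
    intro x hx
    rw [toEuclideanLin_swap_eq_transvection]
    exact Submodule.add_mem _ hx (Submodule.smul_mem _ _ hvW)
  let φ : Module.Dual ℂ (EuclideanSpace ℂ (Fin n)) :=
    (EuclideanSpace.proj i - EuclideanSpace.proj j : EuclideanSpace ℂ (Fin n) →L[ℂ] ℂ)
  have hres : (Matrix.toEuclideanLin (Matrix.swap ℂ i j)).restrict hinv =
      LinearMap.transvection (φ ∘ₗ (fixedSpace g)ᗮ.subtype) ⟨v, hvW⟩ := by
    ext1 x
    apply Subtype.ext
    rw [LinearMap.restrict_apply, LinearMap.transvection.apply]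
    simp only [toEuclideanLin_swap_eq_transvection]
    rfl
  rw [chi, detOn, dif_pos hinv, hres, LinearMap.transvection.det]
  simp [φ, hv, hij, hij.symm]

theorem act_linearForm_swap {n : ℕ} (i j : Fin n) {c : Fin n → ℂ} (hc : c i = c j) :
    act (Matrix.swap ℂ i j) (∑ k, C (c k) * X k) = ∑ k, C (c k) * X k := by
  have hX (k : Fin n) : act (Matrix.swap ℂ i j) (X k) = X (Equiv.swap i j k) := by
    simp only [act, aeval_X]
    rw [Finset.sum_eq_single (Equiv.swap i j k)] <;>
      simp [Matrix.swap, Equiv.Perm.permMatrix, PEquiv.toMatrix_apply]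
    intro b hb h
    exact absurd (by simp [← h]) hb
  simp only [map_sum, map_mul, hX, algHom_C, algebraMap_eq]
  rw [← Equiv.sum_comp (Equiv.swap i j)]
  refine Finset.sum_congr rfl fun k _ => ?_
  rw [Equiv.swap_apply_self, Equiv.swap_apply_def]
  split_ifs <;> simp_all

/-- If `V^g` lies in the hyperplane `x_i = x_j`, then the transposition `(i, j)` acts trivially
on `S(V^g)`. -/
theorem act_swap_eq_self {n : ℕ} {i j : Fin n} {g : Matrix (Fin n) (Fin n) ℂ}
    (hg : ∀ c : Fin n → ℂ, g.mulVec c = c → c i = c j) {f : MvPolynomial (Fin n) ℂ}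
    (hf : f ∈ SVg g) : act (Matrix.swap ℂ i j) f = f := by
  have hle : SVg g ≤ AlgHom.equalizer (act (Matrix.swap ℂ i j)) (AlgHom.id ℂ _) := by
    refine Algebra.adjoin_le ?_
    rintro q ⟨c, hc, rfl⟩
    exact act_linearForm_swap i j (hg c hc)
  exact hle hf

theorem swap_mem_GG (r p : ℕ) {n : ℕ} (i j : Fin n) : Matrix.swap ℂ i j ∈ GG r p n := by
  refine ⟨⟨Equiv.swap i j, fun _ => 1, by simp, fun k l => ?_⟩, ?_⟩
  · simp only [Matrix.swap, Equiv.Perm.permMatrix, PEquiv.toMatrix_apply, Equiv.toPEquiv_apply,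
      Option.mem_some_iff, Equiv.swap_apply_eq_iff]
  · simp [Matrix.swap, Equiv.Perm.permMatrix, PEquiv.toMatrix_apply]

/-- If `V^g` lies in the hyperplane `x_i = x_j` and `g` commutes with the transposition `(i, j)`,
then there are no nonzero `χ_g`-semi-invariants. -/
theorem semiinvariants_eq_zero_of_swap_commute (r p : ℕ) {n : ℕ} {i j : Fin n} (hij : i ≠ j)
    {g : Matrix (Fin n) (Fin n) ℂ} (hg : ∀ c : Fin n → ℂ, g.mulVec c = c → c i = c j)
    (hcomm : Matrix.swap ℂ i j * g = g * Matrix.swap ℂ i j) {f : MvPolynomial (Fin n) ℂ}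
    (hf : f ∈ SVg g) (hsemi : ∀ h ∈ Zg r p n g, act h f = chi g h • f) : f = 0 := by
  have h := hsemi _ ⟨swap_mem_GG r p i j, hcomm⟩
  rw [act_swap_eq_self hg hf, chi_swap hij hg, neg_one_smul] at h
  exact self_eq_neg.mp h

/-- Assume `n ≥ 4`, and let `G = G(r,p,n)` and
`g = (1,2)·ξ₃^{a}ξ₄^{−a}·(3,4)` for any integer `a` (note `g ∈ G(r,p,n)` automatically).
Then the `χ_g`-semi-invariants vanish: `S(V^g)^{χ_g} = 0`. -/
theorem semiinvariants_vanish_double_transposition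
    (r p n : ℕ) [NeZero n] (hn : 4 ≤ n) (hr : 0 < r) (hp : 0 < p) (hpr : p ∣ r)
    (ξ : ℂ) (hξ : IsPrimitiveRoot ξ r) (a : ℤ)
    (g : Matrix (Fin n) (Fin n) ℂ)
    (hg : g = Matrix.of fun i j : Fin n =>
        if i = ((Equiv.swap (0 : Fin n) 1).trans (Equiv.swap (2 : Fin n) 3)) j then
          (if j = 2 then ξ ^ (-a) else if j = 3 then ξ ^ a else 1)
        else 0) :
    ∀ f ∈ SVg g, (∀ h ∈ Zg r p n g, act h f = chi g h • f) → f = 0 := by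
  have hne {k l : ℕ} (hk : k < 4) (hl : l < 4) (hkl : k ≠ l) : Fin.ofNat n k ≠ Fin.ofNat n l := by
    rwa [Ne, Fin.ext_iff, Fin.val_ofNat, Fin.val_ofNat, Nat.mod_eq_of_lt (hk.trans_le hn),
      Nat.mod_eq_of_lt (hl.trans_le hn)]
  have h01 : (0 : Fin n) ≠ 1 := hne (by norm_num) (by norm_num) (by norm_num)
  have h02 : (0 : Fin n) ≠ 2 := hne (by norm_num) (by norm_num) (by norm_num)
  have h03 : (0 : Fin n) ≠ 3 := hne (by norm_num) (by norm_num) (by norm_num)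
  have h12 : (1 : Fin n) ≠ 2 := hne (by norm_num) (by norm_num) (by norm_num)
  have h13 : (1 : Fin n) ≠ 3 := hne (by norm_num) (by norm_num) (by norm_num)
  have h23 : (2 : Fin n) ≠ 3 := hne (by norm_num) (by norm_num) (by norm_num)
  intro f hf hsemi
  refine semiinvariants_eq_zero_of_swap_commute r p h01 (fun c hc => ?_) ?_ hf hsemi
  · have hc0 := congrFun hc 0
    rw [hg, Matrix.mulVec, dotProduct, Finset.sum_eq_single 1] at hc0
    · simpa [h12, h13, Equiv.swap_apply_of_ne_of_ne h02 h03] using hc0.symm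
    · intro k _ hk
      simp only [Matrix.of_apply, Equiv.trans_apply, Equiv.swap_apply_def]
      grind
    · simp
  · ext k l
    simp only [Matrix.swap, Equiv.Perm.permMatrix, PEquiv.toMatrix_toPEquiv_mul,
      PEquiv.mul_toMatrix_toPEquiv, Matrix.submatrix_apply, id, Equiv.symm_swap, hg,
      Matrix.of_apply, Equiv.trans_apply, Equiv.swap_apply_def]
    grind

end
end
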